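/- arXiv:2502.06497 — 11 statements merged into one kernel-verified Lean document; each statement's English description precedes it below -/
import Mathlib

section
/- (Lemma 3.9(1) for 2-2 type tetrahedra, negative part.) For every l = (l12, l13, l14, l23, l24, l34) ∈ ℛ (that is, with l12 > 0), one has φ12(l) ≤ −1 if and only if φ34(l) ≤ −1. -/
open Real

/-- Extended angle-cosine `φ₁₂` of a decorated 2-2 type hyperbolic tetrahedron
(vertices 1,2 hyper-ideal, vertices 3,4 ideal). -/
noncomputable def phi12 (l12 l13 l14 l23 l24 l34 : ℝ) : ℝ :=
  ((exp l13 + exp l23 * cosh l12) * (exp l14 + exp l24 * cosh l12)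
      - (2 * exp l34 + exp (l23 + l24)) * (sinh l12) ^ 2) /
    Real.sqrt ((exp (2 * l23) + 2 * exp (l23 + l13) * cosh l12 + exp (2 * l13)) *
      (exp (2 * l14) + 2 * exp (l24 + l14) * cosh l12 + exp (2 * l24)))

/-- Extended angle-cosine `φ₃₄` of a decorated 2-2 type hyperbolic tetrahedron. -/
noncomputable def phi34 (l12 l13 l14 l23 l24 l34 : ℝ) : ℝ :=
  (exp (l24 + l13) + exp (l14 + l23) - 2 * exp l34 * cosh l12) /
    (2 * Real.sqrt ((exp (l24 + l23) + exp l34) * (exp (l14 + l13) + exp l34)))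

/-- Extended angle-cosine `φ_ik` of a decorated 2-2 type hyperbolic tetrahedron, where
`{i,j} = {1,2}`, `{k,h} = {3,4}`, written in the variables
`(l_ij, l_kh, l_ik, l_ih, l_jk, l_jh)`. -/
noncomputable def phiIK (lij lkh lik lih ljk ljh : ℝ) : ℝ :=
  ((2 * exp (lkh - lik - lih) + 1) * (exp ljk + exp lik * cosh lij)
      - (exp (ljh + lik - lih) + exp lik * cosh lij)) /
    (2 * Real.sqrt ((exp (2 * (lkh - lik - lih)) + exp (lkh - lik - lih)) *
      (exp (2 * ljk) + 2 * exp (lik + ljk) * cosh lij + exp (2 * lik))))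

/-- `φ₁₃` : take `i=1, j=2, k=3, h=4`. -/
noncomputable def phi13 (l12 l13 l14 l23 l24 l34 : ℝ) : ℝ :=
  phiIK l12 l34 l13 l14 l23 l24

/-- `φ₁₄` : take `i=1, j=2, k=4, h=3`. -/
noncomputable def phi14 (l12 l13 l14 l23 l24 l34 : ℝ) : ℝ :=
  phiIK l12 l34 l14 l13 l24 l23

/-- `φ₂₃` : take `i=2, j=1, k=3, h=4`. -/
noncomputable def phi23 (l12 l13 l14 l23 l24 l34 : ℝ) : ℝ :=
  phiIK l12 l34 l23 l24 l13 l14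

/-- `φ₂₄` : take `i=2, j=1, k=4, h=3`. -/
noncomputable def phi24 (l12 l13 l14 l23 l24 l34 : ℝ) : ℝ :=
  phiIK l12 l34 l24 l23 l14 l13

/-- A quotient by a square root is at most `-1` exactly when the numerator is nonpositive and its
square dominates the radicand. -/
lemma div_sqrt_le_neg_one_iff {N D : ℝ} (hD : 0 < D) :
    N / √D ≤ -1 ↔ N ≤ 0 ∧ D ≤ N ^ 2 := by
  rw [div_le_iff₀ (Real.sqrt_pos.2 hD), neg_one_mul, le_neg, Real.sqrt_le_iff, neg_nonneg, neg_sq]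

/-- The algebraic core, where `a, b, c, d, z` stand for the exponentials of the edge lengths and `C` is
the hyperbolic cosine of the remaining one. -/
lemma numerators_le_zero_and_radicands_le_sq_iff {a b c d z C : ℝ}
    (ha : 0 < a) (hb : 0 < b) (hc : 0 < c) (hd : 0 < d) (hC : 1 < C) :
    ((a + c * C) * (b + d * C) - (2 * z + c * d) * (C ^ 2 - 1) ≤ 0 ∧
      (c ^ 2 + 2 * (c * a) * C + a ^ 2) * (b ^ 2 + 2 * (d * b) * C + d ^ 2) ≤
        ((a + c * C) * (b + d * C) - (2 * z + c * d) * (C ^ 2 - 1)) ^ 2) ↔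
    (d * a + b * c - 2 * z * C ≤ 0 ∧
      4 * ((d * c + z) * (b * a + z)) ≤ (d * a + b * c - 2 * z * C) ^ 2) := by
  have hC0 : 0 < C := by linarith
  have hS : 0 < C ^ 2 - 1 := by nlinarith
  have radicands : (c ^ 2 + 2 * (c * a) * C + a ^ 2) * (b ^ 2 + 2 * (d * b) * C + d ^ 2) ≤
        ((a + c * C) * (b + d * C) - (2 * z + c * d) * (C ^ 2 - 1)) ^ 2 ↔
      4 * ((d * c + z) * (b * a + z)) ≤ (d * a + b * c - 2 * z * C) ^ 2 := by
    rw [← sub_nonneg, ← sub_nonneg (b := 4 * ((d * c + z) * (b * a + z))),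
      ← mul_nonneg_iff_of_pos_left (b := _ - 4 * ((d * c + z) * (b * a + z))) hS]
    ring_nf
  rw [radicands]
  refine and_congr_left fun hF => ⟨fun h => ?_, fun h => ?_⟩
  · have hpos : 0 < C * (a * b + c * d) + (d * a + b * c) := by positivity
    have key : (C ^ 2 - 1) * (d * a + b * c - 2 * z * C) ≤ 0 := by
      nlinarith [mul_nonneg hC0.le (neg_nonneg.2 h)]
    exact nonpos_of_mul_nonpos_right key hS
  · by_contra! hN
    have hpos : 0 < (2 * (c * d) * C + (d * a + b * c)) * (2 * (a * b) * C + (d * a + b * c)) := by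
      positivity
    have hsum : 0 < 2 * C * ((a + c * C) * (b + d * C) - (2 * z + c * d) * (C ^ 2 - 1)) +
        (C ^ 2 - 1) * (2 * z * C - (d * a + b * c)) := by
      have := mul_nonneg hS.le (neg_nonneg.2 h)
      have := mul_pos hC0 hN
      linarith
    have hprod := mul_nonneg (neg_nonneg.2 h) hsum.le
    have hF' := mul_nonneg (sq_nonneg C) (sub_nonneg.2 hF)
    nlinarith

/-- Lemma 3.9(1) for 2-2 type tetrahedra, negative part: for `l12 > 0`,
`φ₁₂(l) ≤ −1` iff `φ₃₄(l) ≤ −1`. -/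
theorem phi12_le_neg_one_iff_phi34 (l12 l13 l14 l23 l24 l34 : ℝ) (h : 0 < l12) :
    phi12 l12 l13 l14 l23 l24 l34 ≤ -1 ↔ phi34 l12 l13 l14 l23 l24 l34 ≤ -1 := by
  have hC : 1 < cosh l12 := Real.one_lt_cosh.2 h.ne'
  have hC0 : 0 < cosh l12 := by linarith
  have exp_two_mul (x : ℝ) : exp (2 * x) = exp x ^ 2 := by rw [← Real.exp_nat_mul]; norm_num
  have two_mul_sqrt (x : ℝ) : 2 * √x = √(4 * x) := by
    rw [Real.sqrt_mul (by norm_num), show (4 : ℝ) = 2 ^ 2 by norm_num, Real.sqrt_sq (by norm_num)]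
  unfold phi12 phi34
  rw [two_mul_sqrt, div_sqrt_le_neg_one_iff (by positivity), div_sqrt_le_neg_one_iff (by positivity)]
  simp only [Real.exp_add, exp_two_mul, Real.sinh_sq]
  exact numerators_le_zero_and_radicands_le_sq_iff (exp_pos _) (exp_pos _) (exp_pos _) (exp_pos _)
    hC
end

section
/- (Lemma 3.9(1) for 2-2 type tetrahedra, positive part.) For every l = (l12, l13, l14, l23, l24, l34) ∈ ℛ (that is, with l12 > 0), one has φ12(l) ≥ 1 if and only if φ34(l) ≥ 1. -/
open Real

/-- The two angle-cosine inequalities, cleared of square roots and denominators, with `x` in the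
role of `cosh l12` and `a, b, c, d, t` in the roles of the exponentials of
`l13, l23, l14, l24, l34`. -/
lemma cleared_inequalities_iff {a b c d t x : ℝ} (ha : 0 < a) (hb : 0 < b) (hc : 0 < c)
    (hd : 0 < d) (ht : 0 < t) (hx : 1 < x) :
    (0 ≤ (a + b * x) * (c + d * x) - (2 * t + b * d) * (x ^ 2 - 1) ∧
      (b ^ 2 + 2 * (b * a) * x + a ^ 2) * (c ^ 2 + 2 * (d * c) * x + d ^ 2) ≤
        ((a + b * x) * (c + d * x) - (2 * t + b * d) * (x ^ 2 - 1)) ^ 2) ↔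
    (0 ≤ (d * a + c * b - 2 * t * x) / 2 ∧
      (d * b + t) * (c * a + t) ≤ ((d * a + c * b - 2 * t * x) / 2) ^ 2) := by
  have hs : 0 < x ^ 2 - 1 := by nlinarith
  have hac := mul_pos ha hc
  have hbd := mul_pos hb hd
  have had := mul_pos ha hd
  have hbc := mul_pos hb hc
  have hfactor : ((a + b * x) * (c + d * x) - (2 * t + b * d) * (x ^ 2 - 1)) ^ 2 -
      (b ^ 2 + 2 * (b * a) * x + a ^ 2) * (c ^ 2 + 2 * (d * c) * x + d ^ 2) =
      4 * (x ^ 2 - 1) *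
        (((d * a + c * b - 2 * t * x) / 2) ^ 2 - (d * b + t) * (c * a + t)) := by
    ring
  have hiff : (b ^ 2 + 2 * (b * a) * x + a ^ 2) * (c ^ 2 + 2 * (d * c) * x + d ^ 2) ≤
        ((a + b * x) * (c + d * x) - (2 * t + b * d) * (x ^ 2 - 1)) ^ 2 ↔
      (d * b + t) * (c * a + t) ≤ ((d * a + c * b - 2 * t * x) / 2) ^ 2 := by
    rw [← sub_nonneg, hfactor, mul_nonneg_iff_of_pos_left (by positivity), sub_nonneg]
  rw [hiff]
  refine and_congr_left fun hQ => ⟨fun hN => ?_, fun hM => ?_⟩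
  · by_contra! hM
    have h1 : 0 < (d * a + c * b) * (2 * t * x - (d * a + c * b)) :=
      mul_pos (by nlinarith) (by linarith)
    have h2 := mul_nonneg ht.le hN
    have h3 := mul_pos ht hac
    have h4 := mul_pos ht hbd
    have h5 := mul_pos hac hbd
    nlinarith
  · have h1 : 0 ≤ x * (d * a + c * b - 2 * t * x) := mul_nonneg (by linarith) (by linarith)
    nlinarith

/-- Lemma 3.9(1) for 2-2 type tetrahedra, positive part: for `l12 > 0`,
`φ₁₂(l) ≥ 1` iff `φ₃₄(l) ≥ 1`. -/
theorem phi12_ge_one_iff_phi34 (l12 l13 l14 l23 l24 l34 : ℝ) (h : 0 < l12) :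
    1 ≤ phi12 l12 l13 l14 l23 l24 l34 ↔ 1 ≤ phi34 l12 l13 l14 l23 l24 l34 := by
  have hx : 1 < cosh l12 := one_lt_cosh.2 h.ne'
  have hx0 := cosh_pos l12
  have hexp : ∀ y : ℝ, exp (2 * y) = exp y ^ 2 := fun y => by rw [two_mul, exp_add, sq]
  unfold phi12 phi34
  rw [one_le_div (by positivity), one_le_div (by positivity), ← le_div_iff₀' two_pos,
    Real.sqrt_le_iff, Real.sqrt_le_iff, sinh_sq]
  simp only [exp_add, hexp]
  exact cleared_inequalities_iff (exp_pos _) (exp_pos _) (exp_pos _) (exp_pos _) (exp_pos _) hx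
end

section
/- (Lemma 3.9(2) for 2-2 type tetrahedra, disjointness.) There is no l = (l12, l13, l14, l23, l24, l34) ∈ ℛ (that is, with l12 > 0) such that simultaneously φ12(l) ≤ −1 and φ13(l) ≤ −1; in other words, the sets Ω12⁻ = {l ∈ ℛ : φ12(l) ≤ −1} and Ω13⁻ = {l ∈ ℛ : φ13(l) ≤ −1} are disjoint. -/
open Real

/-- A quotient with nonnegative denominator that is at most `-1` has negative numerator. -/
lemma neg_of_div_le_neg_one {n d : ℝ} (hd : 0 ≤ d) (h : n / d ≤ -1) : n < 0 := by
  by_contra! hn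
  linarith [div_nonneg hn hd]

/-- If `φ₁₂ ≤ -1`, then `e^{l₂₄} (e^{l₂₃} + e^{l₁₃} cosh l₁₂) < 2 e^{l₃₄} sinh² l₁₂`. -/
lemma lt_of_phi12_le_neg_one {l12 l13 l14 l23 l24 l34 : ℝ}
    (h : phi12 l12 l13 l14 l23 l24 l34 ≤ -1) :
    exp l24 * (exp l23 + exp l13 * cosh l12) < 2 * exp l34 * sinh l12 ^ 2 := by
  have hn := neg_of_div_le_neg_one (Real.sqrt_nonneg _) h
  rw [exp_add, sinh_sq] at hn
  rw [sinh_sq]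
  have hab := mul_pos (exp_pos l13) (exp_pos l14)
  have hpb := mul_pos (mul_pos (exp_pos l23) (exp_pos l14)) (cosh_pos l12)
  linarith

/-- If `φ₁₃ ≤ -1`, then `2 e^{l₃₄} (e^{l₂₃} + e^{l₁₃} cosh l₁₂) < e^{l₂₄} e^{2 l₁₃}`. -/
lemma lt_of_phi13_le_neg_one {l12 l13 l14 l23 l24 l34 : ℝ}
    (h : phi13 l12 l13 l14 l23 l24 l34 ≤ -1) :
    2 * exp l34 * (exp l23 + exp l13 * cosh l12) < exp l24 * exp l13 ^ 2 := by
  have hn := neg_of_div_le_neg_one (by positivity) h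
  simp only [exp_sub, exp_add] at hn
  have hlt : 2 * (exp l34 / exp l13 / exp l14) * (exp l23 + exp l13 * cosh l12) <
      exp l24 * exp l13 / exp l14 := by
    linarith [exp_pos l23]
  have hmul := mul_lt_mul_of_pos_right hlt (mul_pos (exp_pos l13) (exp_pos l14))
  field_simp at hmul
  linarith

/-- Lemma 3.9(2) for 2-2 type tetrahedra, disjointness: there is no `l` with `l12 > 0` such
that simultaneously `φ₁₂(l) ≤ −1` and `φ₁₃(l) ≤ −1`, i.e. `Ω₁₂⁻ ∩ Ω₁₃⁻ = ∅`. -/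
theorem Omega12_neg_disjoint_Omega13_neg (l12 l13 l14 l23 l24 l34 : ℝ) (h : 0 < l12) :
    ¬ (phi12 l12 l13 l14 l23 l24 l34 ≤ -1 ∧ phi13 l12 l13 l14 l23 l24 l34 ≤ -1) := by
  rintro ⟨h12, h13⟩
  have h1 := lt_of_phi12_le_neg_one h12
  have h2 := lt_of_phi13_le_neg_one h13
  have hc : 0 < exp l23 + exp l13 * cosh l12 := by positivity
  have h3 := mul_lt_mul_of_pos_right h1 (pow_pos (exp_pos l13) 2)
  have h4 := mul_lt_mul_of_pos_right h2 hc
  have h5 : (exp l13 * cosh l12) ^ 2 ≤ (exp l23 + exp l13 * cosh l12) ^ 2 :=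
    pow_le_pow_left₀ (by positivity) (by linarith [exp_pos l23]) 2
  have h6 := mul_le_mul_of_nonneg_left h5 (exp_pos l34).le
  have h7 := mul_pos (exp_pos l34) (pow_pos (exp_pos l13) 2)
  rw [sinh_sq] at h3
  linarith
end

section
/- (Lemma 3.9(2) for 2-2 type tetrahedra: Ω12⁺ = Ω13⁻ ⊔ Ω14⁻.) For every l = (l12, l13, l14, l23, l24, l34) ∈ ℛ (that is, with l12 > 0), one has φ12(l) ≥ 1 if and only if (φ13(l) ≤ −1 or φ14(l) ≤ −1); moreover φ13(l) ≤ −1 and φ14(l) ≤ −1 cannot hold simultaneously. -/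
open Real

/-- The quadratic in `p` whose sign governs all the extended dihedral angles: up to positive
factors it is the square of the numerator minus the square of the denominator of each
angle-cosine. -/
def angleDiscr (a b c d p C : ℝ) : ℝ :=
  (a * d - b * c) ^ 2 - 4 * p * (a * b + c * d + C * (a * d + b * c)) + 4 * p ^ 2 * (C ^ 2 - 1)

lemma angleDiscr_swap (a b c d p C : ℝ) : angleDiscr b a d c p C = angleDiscr a b c d p C := by
  unfold angleDiscr; ring

lemma one_le_div_sqrt_iff {n D : ℝ} (hD : 0 < D) : 1 ≤ n / √D ↔ 0 ≤ n ∧ D ≤ n ^ 2 := by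
  rw [one_le_div (Real.sqrt_pos.2 hD), Real.sqrt_le_iff]

lemma div_two_mul_sqrt_le_neg_one_iff {n D : ℝ} (hD : 0 < D) :
    n / (2 * √D) ≤ -1 ↔ n ≤ 0 ∧ 4 * D ≤ n ^ 2 := by
  have h : n / (2 * √D) ≤ -1 ↔ √D ≤ -n / 2 := by
    rw [div_le_iff₀ (by positivity)]
    constructor <;> intro h <;> linarith
  rw [h, Real.sqrt_le_iff]
  constructor <;> rintro ⟨h₁, h₂⟩ <;> constructor <;> linarith

lemma one_le_phi12_iff {l12 l13 l14 l23 l24 l34 : ℝ} (h : 0 < l12) :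
    1 ≤ phi12 l12 l13 l14 l23 l24 l34 ↔
      0 ≤ exp l13 * exp l14 + exp l23 * exp l24
          + cosh l12 * (exp l13 * exp l24 + exp l14 * exp l23)
          - 2 * exp l34 * (cosh l12 ^ 2 - 1) ∧
        0 ≤ angleDiscr (exp l13) (exp l14) (exp l23) (exp l24) (exp l34) (cosh l12) := by
  have hC : 1 < cosh l12 := Real.one_lt_cosh.2 h.ne'
  unfold phi12 angleDiscr
  rw [one_le_div_sqrt_iff (by positivity), Real.sinh_sq]
  simp only [two_mul l13, two_mul l14, two_mul l23, two_mul l24, Real.exp_add]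
  generalize exp l13 = a, exp l14 = b, exp l23 = c, exp l24 = d, exp l34 = p,
    cosh l12 = C at *
  refine and_congr ?_ ?_
  · rw [iff_iff_eq]; congr 1; ring
  · have hS : 0 < C ^ 2 - 1 := by nlinarith
    refine sub_nonneg.symm.trans (Iff.trans ?_ (mul_nonneg_iff_of_pos_left hS))
    rw [iff_iff_eq]; congr 1; ring

lemma phiIK_le_neg_one_iff (lij lkh lik lih ljk ljh : ℝ) :
    phiIK lij lkh lik lih ljk ljh ≤ -1 ↔
      2 * exp lkh * (exp ljk + exp lik * cosh lij)
          + exp lik * (exp lih * exp ljk - exp lik * exp ljh) ≤ 0 ∧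
        0 ≤ angleDiscr (exp lik) (exp lih) (exp ljk) (exp ljh) (exp lkh) (cosh lij) := by
  have hC : 0 < cosh lij := Real.cosh_pos lij
  unfold phiIK angleDiscr
  rw [div_two_mul_sqrt_le_neg_one_iff (by positivity)]
  simp only [two_mul lik, two_mul ljk, two_mul (lkh - lik - lih), Real.exp_add, Real.exp_sub]
  have ha := Real.exp_pos lik
  have hb := Real.exp_pos lih
  generalize exp lik = a, exp lih = b, exp ljk = c, exp ljh = d, exp lkh = p,
    cosh lij = C at *
  refine and_congr ?_ ?_
  · refine (mul_le_mul_iff_right₀ (mul_pos ha hb)).symm.trans ?_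
    rw [mul_zero, iff_iff_eq]; congr 1; field_simp; ring
  · refine sub_nonneg.symm.trans ((mul_nonneg_iff_of_pos_left (pow_pos hb 2)).symm.trans ?_)
    rw [iff_iff_eq]; congr 1; field_simp; ring

lemma phi12_num_nonneg {a b c d p C : ℝ} (ha : 0 < a) (hb : 0 < b) (hc : 0 < c) (hd : 0 < d)
    (hp : 0 < p) (hC : 1 < C) (h : 2 * p * (c + a * C) + a * (b * c - a * d) ≤ 0) :
    0 ≤ a * b + c * d + C * (a * d + b * c) - 2 * p * (C ^ 2 - 1) := by
  have hC0 : 0 < C := by linarith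
  have h₁ : 2 * p * C ≤ a * d := by
    refine le_of_mul_le_mul_left ?_ ha
    have := mul_pos hp hc
    have := mul_pos ha (mul_pos hb hc)
    nlinarith
  have h₂ := mul_le_mul_of_nonneg_left h₁ hC0.le
  have := mul_pos ha hb
  have := mul_pos hc hd
  have := mul_pos hC0 (mul_pos hb hc)
  nlinarith

lemma phiIK_num_nonpos {a b c d p C : ℝ} (ha : 0 < a) (hb : 0 < b) (hc : 0 < c)
    (hp : 0 < p) (hC : 1 < C)
    (hN : 0 ≤ a * b + c * d + C * (a * d + b * c) - 2 * p * (C ^ 2 - 1))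
    (hQ : 0 ≤ angleDiscr a b c d p C) (ht : b * c ≤ a * d) :
    2 * p * (c + a * C) + a * (b * c - a * d) ≤ 0 := by
  by_contra! hM
  have hC0 : 0 < C := by linarith
  have hs : 0 ≤ a * d - b * c := by linarith
  have h₁ : 2 * p * (a * b + c * d + C * (a * d + b * c)) ≤ (a * d - b * c) ^ 2 := by
    unfold angleDiscr at hQ
    nlinarith [mul_nonneg hp.le hN]
  have h₂ : a * (a * d - b * c) ^ 2 ≤ 2 * p * ((c + a * C) * (a * d - b * c)) := by
    nlinarith [mul_nonneg hs hM.le]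
  have h₃ : 0 < 2 * p * (b * c ^ 2 + 2 * a * b * c * C + a ^ 2 * b) := by positivity
  nlinarith [mul_le_mul_of_nonneg_left h₁ ha.le]

/-- Lemma 3.9(2) for 2-2 type tetrahedra, `Ω₁₂⁺ = Ω₁₃⁻ ⊔ Ω₁₄⁻`: for `l12 > 0`,
`φ₁₂(l) ≥ 1` iff (`φ₁₃(l) ≤ −1` or `φ₁₄(l) ≤ −1`), and the two alternatives are
mutually exclusive. -/
theorem Omega12_pos_eq_disjoint_union (l12 l13 l14 l23 l24 l34 : ℝ) (h : 0 < l12) :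
    (1 ≤ phi12 l12 l13 l14 l23 l24 l34 ↔
      (phi13 l12 l13 l14 l23 l24 l34 ≤ -1 ∨ phi14 l12 l13 l14 l23 l24 l34 ≤ -1)) ∧
    ¬ (phi13 l12 l13 l14 l23 l24 l34 ≤ -1 ∧ phi14 l12 l13 l14 l23 l24 l34 ≤ -1) := by
  have hC : 1 < cosh l12 := Real.one_lt_cosh.2 h.ne'
  rw [one_le_phi12_iff h, phi13, phi14, phiIK_le_neg_one_iff, phiIK_le_neg_one_iff,
    angleDiscr_swap (exp l13)]
  have ha := Real.exp_pos l13
  have hb := Real.exp_pos l14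
  have hc := Real.exp_pos l23
  have hd := Real.exp_pos l24
  have hp := Real.exp_pos l34
  generalize exp l13 = a, exp l14 = b, exp l23 = c, exp l24 = d, exp l34 = p,
    cosh l12 = C at *
  have hC0 : 0 < C := by linarith
  refine ⟨⟨?_, ?_⟩, ?_⟩
  · rintro ⟨hN, hQ⟩
    rcases le_total (b * c) (a * d) with ht | ht
    · exact Or.inl ⟨phiIK_num_nonpos ha hb hc hp hC hN hQ ht, hQ⟩
    · refine Or.inr ⟨phiIK_num_nonpos hb ha hd hp hC (by linarith) ?_ ht, hQ⟩
      rwa [angleDiscr_swap]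
  · rintro (⟨hM, hQ⟩ | ⟨hM, hQ⟩)
    · exact ⟨phi12_num_nonneg ha hb hc hd hp hC hM, hQ⟩
    · exact ⟨by linarith [phi12_num_nonneg hb ha hd hc hp hC hM], hQ⟩
  · rintro ⟨⟨h₁, -⟩, h₂, -⟩
    have h₃ : 0 < 2 * p * (c + a * C) := by positivity
    have h₄ : 0 < 2 * p * (d + b * C) := by positivity
    have h₅ : b * c - a * d < 0 := (pos_iff_neg_of_mul_neg (by linarith)).1 ha
    have h₆ : a * d - b * c < 0 := (pos_iff_neg_of_mul_neg (by linarith)).1 hb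
    linarith
end

section
/- (Lemma 3.9(2) for 2-2 type tetrahedra: Ω12⁻ = Ω13⁺ ∩ Ω14⁺.) For every l = (l12, l13, l14, l23, l24, l34) ∈ ℛ (that is, with l12 > 0), one has φ12(l) ≤ −1 if and only if both φ13(l) ≥ 1 and φ14(l) ≥ 1. -/
open Real

lemma one_le_div_two_mul_sqrt_iff {n s : ℝ} (hs : 0 < s) :
    1 ≤ n / (2 * √s) ↔ 0 ≤ n ∧ 4 * s ≤ n ^ 2 := by
  have h2 : 2 * √s = √(4 * s) := by
    rw [Real.sqrt_mul (by norm_num), show (4 : ℝ) = 2 ^ 2 by norm_num,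
      Real.sqrt_sq (by norm_num)]
  rw [h2, one_le_div (Real.sqrt_pos.mpr (by positivity)), Real.sqrt_le_iff]

lemma div_sqrt_le_neg_one_iff_s8 {n s : ℝ} (hs : 0 < s) :
    n / √s ≤ -1 ↔ 0 ≤ -n ∧ s ≤ n ^ 2 := by
  rw [div_le_iff₀ (Real.sqrt_pos.mpr hs), neg_one_mul, le_neg, Real.sqrt_le_iff, neg_sq]

/-- `φ_ik ≥ 1` as a linear and a quadratic inequality in `exp l_kh`; the quadratic one is
unchanged under exchanging `k` and `h`. -/
lemma one_le_phiIK_iff (lij lkh lik lih ljk ljh : ℝ) :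
    1 ≤ phiIK lij lkh lik lih ljk ljh ↔
      0 ≤ 2 * exp lkh * (exp ljk + exp lik * cosh lij)
          + exp lik * (exp lih * exp ljk - exp lik * exp ljh) ∧
      0 ≤ (2 * exp lkh) ^ 2 * (cosh lij ^ 2 - 1)
          - 2 * (2 * exp lkh) * (exp lik * exp lih + exp ljk * exp ljh
            + (exp lik * exp ljh + exp lih * exp ljk) * cosh lij)
          + (exp lih * exp ljk - exp lik * exp ljh) ^ 2 := by
  have hC : 0 < cosh lij := cosh_pos lij
  rw [phiIK, one_le_div_two_mul_sqrt_iff (by positivity)]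
  simp only [two_mul lik, two_mul ljk, two_mul (lkh - lik - lih), exp_add, exp_sub]
  have ha := exp_pos lik
  have hb := exp_pos lih
  generalize exp lik = a at *
  generalize exp lih = b at *
  generalize exp ljk = c at *
  generalize exp ljh = d at *
  generalize exp lkh = z at *
  generalize cosh lij = C at *
  have h1 : (2 * (z / a / b) + 1) * (c + a * C) - (d * a / b + a * C)
      = (2 * z * (c + a * C) + a * (b * c - a * d)) / (a * b) := by
    field_simp
    ring
  have h2 : ((2 * z * (c + a * C) + a * (b * c - a * d)) / (a * b)) ^ 2
      - 4 * ((z / a / b * (z / a / b) + z / a / b) * (c * c + 2 * (a * c) * C + a * a))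
      = ((2 * z) ^ 2 * (C ^ 2 - 1) - 2 * (2 * z) * (a * b + c * d + (a * d + b * c) * C)
          + (b * c - a * d) ^ 2) / b ^ 2 := by
    field_simp
    ring
  rw [h1, ← sub_nonneg (a := (_ : ℝ) ^ 2), h2, le_div_iff₀ (by positivity),
    le_div_iff₀ (by positivity), zero_mul, zero_mul]

lemma phi12_le_neg_one_iff (l12 l13 l14 l23 l24 l34 : ℝ) (h : 0 < l12) :
    phi12 l12 l13 l14 l23 l24 l34 ≤ -1 ↔
      exp l13 * exp l14 + exp l23 * exp l24
          + (exp l13 * exp l24 + exp l14 * exp l23) * cosh l12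
        ≤ 2 * exp l34 * (cosh l12 ^ 2 - 1) ∧
      0 ≤ (2 * exp l34) ^ 2 * (cosh l12 ^ 2 - 1)
          - 2 * (2 * exp l34) * (exp l13 * exp l14 + exp l23 * exp l24
            + (exp l13 * exp l24 + exp l14 * exp l23) * cosh l12)
          + (exp l14 * exp l23 - exp l13 * exp l24) ^ 2 := by
  have hC : 1 < cosh l12 := one_lt_cosh.mpr h.ne'
  have hC0 : 0 < cosh l12 := cosh_pos l12
  have hS : 0 < cosh l12 ^ 2 - 1 := by nlinarith
  rw [phi12, div_sqrt_le_neg_one_iff_s8 (by positivity), sinh_sq]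
  simp only [two_mul l13, two_mul l14, two_mul l23, two_mul l24, exp_add]
  generalize exp l13 = a at *
  generalize exp l14 = b at *
  generalize exp l23 = c at *
  generalize exp l24 = d at *
  generalize exp l34 = z at *
  generalize cosh l12 = C at *
  refine and_congr ?_ ?_
  · rw [← sub_nonneg (b := _ + _)]
    ring_nf
  · rw [← sub_nonneg, iff_comm, ← mul_nonneg_iff_of_pos_left hS]
    ring_nf

/-- A point left of the vertex of `x² S - 2 x K + E²` cannot satisfy both the quadratic
inequality and `b E ≤ x m`, when `E m ≤ b K`. -/
lemma quadratic_neg_of_lt_vertex {x S K E b m : ℝ} (hx : 0 < x) (hb : 0 < b) (hE : 0 ≤ E)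
    (hK : x * S < K) (hm : E * m ≤ b * K) (hr : b * E ≤ x * m) :
    x ^ 2 * S - 2 * x * K + E ^ 2 < 0 := by
  have h1 : b * E ^ 2 ≤ b * (x * K) := by nlinarith
  have h2 : E ^ 2 ≤ x * K := le_of_mul_le_mul_left h1 hb
  nlinarith

/-- Lemma 3.9(2) for 2-2 type tetrahedra, `Ω₁₂⁻ = Ω₁₃⁺ ∩ Ω₁₄⁺`: for `l12 > 0`,
`φ₁₂(l) ≤ −1` iff both `φ₁₃(l) ≥ 1` and `φ₁₄(l) ≥ 1`. -/
theorem Omega12_neg_eq_inter (l12 l13 l14 l23 l24 l34 : ℝ) (h : 0 < l12) :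
    phi12 l12 l13 l14 l23 l24 l34 ≤ -1 ↔
      (1 ≤ phi13 l12 l13 l14 l23 l24 l34 ∧ 1 ≤ phi14 l12 l13 l14 l23 l24 l34) := by
  rw [phi12_le_neg_one_iff _ _ _ _ _ _ h, phi13, phi14, one_le_phiIK_iff, one_le_phiIK_iff]
  have hC : 1 < cosh l12 := one_lt_cosh.mpr h.ne'
  have hC0 : 0 < cosh l12 := cosh_pos l12
  have hS : 0 < cosh l12 ^ 2 - 1 := by nlinarith
  have ha := exp_pos l13
  have hb := exp_pos l14
  have hc := exp_pos l23
  have hd := exp_pos l24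
  have hx : 0 < 2 * exp l34 := by positivity
  generalize exp l13 = a at *
  generalize exp l14 = b at *
  generalize exp l23 = c at *
  generalize exp l24 = d at *
  generalize 2 * exp l34 = x at *
  generalize cosh l12 = C at *
  have key : ∀ {a b c d : ℝ}, 0 < a → 0 < b → 0 < c → 0 < d →
      a * b + c * d + (a * d + b * c) * C ≤ x * (C ^ 2 - 1) →
      0 ≤ x * (c + a * C) + a * (b * c - a * d) := by
    intro a b c d ha hb hc hd hK
    refine (mul_nonneg_iff_of_pos_left hS).mp ?_
    have h1 := mul_le_mul_of_nonneg_right hK (show 0 ≤ c + a * C by positivity)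
    have h2 : 0 ≤ (a * b + c * d + (a * d + b * c) * C) * (c + a * C)
        + a * (b * c - a * d) * (C ^ 2 - 1) := by
      have : (a * b + c * d + (a * d + b * c) * C) * (c + a * C)
          + a * (b * c - a * d) * (C ^ 2 - 1)
          = c * (c * d) + 2 * a * c * d * C + b * c ^ 2 * C + a ^ 2 * b * C
            + 2 * a * b * c * C ^ 2 + a ^ 2 * d := by ring
      rw [this]
      positivity
    linarith
  constructor
  · rintro ⟨hK, hg⟩
    refine ⟨⟨key ha hb hc hd hK, hg⟩, key hb ha hd hc (by linarith), by linarith⟩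
  · rintro ⟨⟨h13, hg⟩, h14, -⟩
    refine ⟨?_, hg⟩
    by_contra! hK
    rcases le_total 0 (b * c - a * d) with hE | hE
    · refine hg.not_gt (quadratic_neg_of_lt_vertex (m := d + b * C) hx hb hE hK ?_ (by linarith))
      have : 0 ≤ a * d ^ 2 + 2 * a * b * d * C + a * b ^ 2 := by positivity
      linarith
    · have hg' := quadratic_neg_of_lt_vertex (E := a * d - b * c) (m := c + a * C) hx ha
        (by linarith) hK ?_ (by linarith)
      · linarith
      · have : 0 ≤ b * c ^ 2 + 2 * a * b * c * C + a ^ 2 * b := by positivity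
        linarith
end

section
/- (Lemma 3.9(4) for 2-2 type tetrahedra: decomposition of the degenerate set.) Define ℒ = {l ∈ ℛ : φ_pq(l) ∈ (−1, 1) for all pairs {p,q} ⊂ {1,2,3,4}}. Then for every l ∈ ℛ (that is, with l12 > 0), l ∉ ℒ if and only if at least one of φ12(l) ≤ −1, φ13(l) ≤ −1, φ14(l) ≤ −1 holds; moreover at most one of these three conditions can hold, so ℛ ∖ ℒ is the disjoint union of the three sets {l ∈ ℛ : φ12(l) ≤ −1}, {l ∈ ℛ : φ13(l) ≤ −1}, {l ∈ ℛ : φ14(l) ≤ −1}. -/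
open Real

/-- Membership in the moduli space `ℒ` of decorated 2-2 type hyperbolic tetrahedra:
all six extended angle-cosines lie in `(−1, 1)`. -/
def memL (l12 l13 l14 l23 l24 l34 : ℝ) : Prop :=
  phi12 l12 l13 l14 l23 l24 l34 ∈ Set.Ioo (-1 : ℝ) 1 ∧
  phi13 l12 l13 l14 l23 l24 l34 ∈ Set.Ioo (-1 : ℝ) 1 ∧
  phi14 l12 l13 l14 l23 l24 l34 ∈ Set.Ioo (-1 : ℝ) 1 ∧
  phi23 l12 l13 l14 l23 l24 l34 ∈ Set.Ioo (-1 : ℝ) 1 ∧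
  phi24 l12 l13 l14 l23 l24 l34 ∈ Set.Ioo (-1 : ℝ) 1 ∧
  phi34 l12 l13 l14 l23 l24 l34 ∈ Set.Ioo (-1 : ℝ) 1

theorem div_mul_sqrt_mem_Ioo_iff {n t d : ℝ} (ht : 0 < t) (hd : 0 < d) :
    n / (t * √d) ∈ Set.Ioo (-1 : ℝ) 1 ↔ n ^ 2 < t ^ 2 * d := by
  have hs : 0 < t * √d := mul_pos ht (sqrt_pos.2 hd)
  rw [Set.mem_Ioo, ← abs_lt, abs_div, abs_of_pos hs, div_lt_one hs,
    ← sq_lt_sq₀ (abs_nonneg n) hs.le, sq_abs, mul_pow, sq_sqrt hd.le]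

theorem div_mul_sqrt_le_neg_one_iff {n t d : ℝ} (ht : 0 < t) (hd : 0 < d) :
    n / (t * √d) ≤ -1 ↔ n ≤ 0 ∧ t ^ 2 * d ≤ n ^ 2 := by
  have hs : 0 < t * √d := mul_pos ht (sqrt_pos.2 hd)
  have hsq : (t * √d) ^ 2 = t ^ 2 * d := by rw [mul_pow, sq_sqrt hd.le]
  rw [div_le_iff₀ hs, ← hsq]
  constructor
  · intro hn
    exact ⟨by linarith, by nlinarith⟩
  · rintro ⟨hn, hle⟩
    have := sq_le_sq.1 hle
    rw [abs_of_pos hs, abs_of_nonpos hn] at this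
    linarith

/-- The negative of the Gram determinant, with `a, b, p, q, z` the exponentials of
`l13, l14, l23, l24, l34` and `c = cosh l12`. -/
def negGramDet (c a b p q z : ℝ) : ℝ :=
  4 * (q * p + z) * (b * a + z) - (q * a + b * p - 2 * z * c) ^ 2

/-- The Gram cofactor whose sign is that of `φ₁₂`. -/
def gramCofactor12 (c a b p q z : ℝ) : ℝ :=
  (a + p * c) * (b + q * c) - (2 * z + p * q) * (c ^ 2 - 1)

/-- The Gram cofactor whose sign is that of `φ_ik`, in the exponentials
of `l_ik, l_ih, l_jk, l_jh, l_kh`. -/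
def gramCofactorIK (c a b p q z : ℝ) : ℝ :=
  2 * z * (p + a * c) + a * (p * b - q * a)

theorem negGramDet_swap_hyperideal (c a b p q z : ℝ) :
    negGramDet c p q a b z = negGramDet c a b p q z := by
  unfold negGramDet; ring

theorem negGramDet_swap_ideal (c a b p q z : ℝ) :
    negGramDet c b a q p z = negGramDet c a b p q z := by
  unfold negGramDet; ring

theorem negGramDet_eq_cofactor_expansion (c a b p q z : ℝ) :
    negGramDet c a b p q z = b * gramCofactorIK c p q a b z + q * gramCofactorIK c a b p q z
      + 2 * z * gramCofactor12 c a b p q z := by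
  unfold negGramDet gramCofactorIK gramCofactor12; ring

section Signs

variable {c a b p q z : ℝ}

theorem not_gramCofactorIK_nonpos_and_nonpos (hc : 0 < c) (ha : 0 < a) (hb : 0 < b) (hp : 0 < p)
    (hq : 0 < q) (hz : 0 < z) :
    ¬ (gramCofactorIK c a b p q z ≤ 0 ∧ gramCofactorIK c b a q p z ≤ 0) := by
  rintro ⟨h₁, h₂⟩
  unfold gramCofactorIK at h₁ h₂
  have h₃ : 0 < 2 * z * (p + a * c) := by positivity
  have h₄ : 0 < 2 * z * (q + b * c) := by positivity
  have h₅ : p * b - q * a < 0 := by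
    by_contra! hle
    nlinarith [mul_nonneg ha.le hle]
  nlinarith [mul_pos hb (neg_pos.2 h₅)]

theorem not_gramCofactor12_nonpos_and_gramCofactorIK_nonpos (hc : 1 < c) (ha : 0 < a) (hb : 0 < b)
    (hp : 0 < p) (hq : 0 < q) :
    ¬ (gramCofactor12 c a b p q z ≤ 0 ∧ gramCofactorIK c a b p q z ≤ 0) := by
  rintro ⟨h₁, h₂⟩
  have hc₀ : 0 < c := by linarith
  have hc₁ : 0 < c ^ 2 - 1 := by nlinarith
  have hsum : 0 < (p + a * c) * gramCofactor12 c a b p q z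
      + (c ^ 2 - 1) * gramCofactorIK c a b p q z := by
    have : (p + a * c) * gramCofactor12 c a b p q z
        + (c ^ 2 - 1) * gramCofactorIK c a b p q z
        = (p + a * c) * (a * b + c * p * b + p * q) + p * c * a * q + a ^ 2 * q
          + a * (c ^ 2 - 1) * p * b := by
      unfold gramCofactorIK gramCofactor12; ring
    rw [this]
    positivity
  have hpac : 0 < p + a * c := by positivity
  nlinarith [mul_nonneg hpac.le (neg_nonneg.2 h₁), mul_nonneg hc₁.le (neg_nonneg.2 h₂)]

theorem gramCofactorIK_nonpos_of_negGramDet_nonpos (hb : 0 < b) (hq : 0 < q) (hz : 0 < z)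
    (hK : negGramDet c a b p q z ≤ 0) (h₁₂ : 0 < gramCofactor12 c a b p q z)
    (hik : 0 < gramCofactorIK c a b p q z) : gramCofactorIK c p q a b z ≤ 0 := by
  by_contra! hjk
  rw [negGramDet_eq_cofactor_expansion] at hK
  have : 0 < b * gramCofactorIK c p q a b z + q * gramCofactorIK c a b p q z
      + 2 * z * gramCofactor12 c a b p q z := by positivity
  linarith

theorem exists_gramCofactor_nonpos (hc : 0 < c) (ha : 0 < a) (hb : 0 < b) (hp : 0 < p)
    (hq : 0 < q) (hz : 0 < z) (hK : negGramDet c a b p q z ≤ 0) :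
    gramCofactor12 c a b p q z ≤ 0 ∨ gramCofactorIK c a b p q z ≤ 0 ∨
      gramCofactorIK c b a q p z ≤ 0 := by
  by_contra! hpos
  obtain ⟨h₁₂, h₁₃, h₁₄⟩ := hpos
  have h₁₂' : 0 < gramCofactor12 c b a q p z := by
    unfold gramCofactor12 at h₁₂ ⊢; linarith
  exact not_gramCofactorIK_nonpos_and_nonpos hc hp hq ha hb hz
    ⟨gramCofactorIK_nonpos_of_negGramDet_nonpos hb hq hz hK h₁₂ h₁₃,
      gramCofactorIK_nonpos_of_negGramDet_nonpos ha hp hz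
        ((negGramDet_swap_ideal c a b p q z).trans_le hK) h₁₂' h₁₄⟩

end Signs

section Angles

variable (l12 l13 l14 l23 l24 l34 : ℝ)

/-- `negGramDet` in the decoration lengths. -/
noncomputable def lengthNegGramDet : ℝ :=
  negGramDet (cosh l12) (exp l13) (exp l14) (exp l23) (exp l24) (exp l34)

theorem phi34_mem_Ioo_iff :
    phi34 l12 l13 l14 l23 l24 l34 ∈ Set.Ioo (-1 : ℝ) 1 ↔
      0 < lengthNegGramDet l12 l13 l14 l23 l24 l34 := by
  rw [phi34, div_mul_sqrt_mem_Ioo_iff two_pos (by positivity), ← sub_pos]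
  simp only [exp_add, lengthNegGramDet, negGramDet]
  ring_nf

theorem phi12_mem_Ioo_iff_and_le_neg_one_iff (h : 0 < l12) :
    (phi12 l12 l13 l14 l23 l24 l34 ∈ Set.Ioo (-1 : ℝ) 1 ↔
      0 < lengthNegGramDet l12 l13 l14 l23 l24 l34) ∧
    (phi12 l12 l13 l14 l23 l24 l34 ≤ -1 ↔
      gramCofactor12 (cosh l12) (exp l13) (exp l14) (exp l23) (exp l24) (exp l34) ≤ 0 ∧
        lengthNegGramDet l12 l13 l14 l23 l24 l34 ≤ 0) := by
  have hs : 0 < cosh l12 ^ 2 - 1 := by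
    nlinarith [one_lt_cosh.2 h.ne']
  set d := (exp (2 * l23) + 2 * exp (l23 + l13) * cosh l12 + exp (2 * l13)) *
      (exp (2 * l14) + 2 * exp (l24 + l14) * cosh l12 + exp (2 * l24)) with hd
  set n := gramCofactor12 (cosh l12) (exp l13) (exp l14) (exp l23) (exp l24) (exp l34) with hn
  have hd₀ : 0 < d := by positivity
  have hphi : phi12 l12 l13 l14 l23 l24 l34 = n / (1 * √d) := by
    rw [phi12, sinh_sq, one_mul, ← hd, hn, gramCofactor12, exp_add]
  have hK : 1 ^ 2 * d - n ^ 2 =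
      lengthNegGramDet l12 l13 l14 l23 l24 l34 * (cosh l12 ^ 2 - 1) := by
    simp only [hd, hn, two_mul, exp_add, lengthNegGramDet, negGramDet, gramCofactor12]
    ring
  rw [hphi, div_mul_sqrt_mem_Ioo_iff one_pos hd₀, div_mul_sqrt_le_neg_one_iff one_pos hd₀,
    ← sub_pos, ← sub_nonpos (a := 1 ^ 2 * d), hK, mul_pos_iff_of_pos_right hs,
    ← not_lt (b := _ * _), mul_pos_iff_of_pos_right hs, not_lt]
  exact ⟨Iff.rfl, Iff.rfl⟩

theorem phiIK_mem_Ioo_iff_and_le_neg_one_iff :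
    (phiIK l12 l34 l13 l14 l23 l24 ∈ Set.Ioo (-1 : ℝ) 1 ↔
      0 < lengthNegGramDet l12 l13 l14 l23 l24 l34) ∧
    (phiIK l12 l34 l13 l14 l23 l24 ≤ -1 ↔
      gramCofactorIK (cosh l12) (exp l13) (exp l14) (exp l23) (exp l24) (exp l34) ≤ 0 ∧
        lengthNegGramDet l12 l13 l14 l23 l24 l34 ≤ 0) := by
  set d := (exp (2 * (l34 - l13 - l14)) + exp (l34 - l13 - l14)) *
      (exp (2 * l23) + 2 * exp (l13 + l23) * cosh l12 + exp (2 * l13)) with hd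
  set m := (2 * exp (l34 - l13 - l14) + 1) * (exp l23 + exp l13 * cosh l12)
      - (exp (l24 + l13 - l14) + exp l13 * cosh l12) with hm
  have hd₀ : 0 < d := by positivity
  have hn : gramCofactorIK (cosh l12) (exp l13) (exp l14) (exp l23) (exp l24) (exp l34) =
      m * (exp l13 * exp l14) := by
    simp only [hm, exp_add, exp_sub, gramCofactorIK]
    field_simp
    ring
  have hK : lengthNegGramDet l12 l13 l14 l23 l24 l34 = (2 ^ 2 * d - m ^ 2) * exp l14 ^ 2 := by
    simp only [hd, hm, two_mul, exp_add, exp_sub, lengthNegGramDet, negGramDet]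
    field_simp
    ring
  have hab : 0 < exp l13 * exp l14 := by positivity
  have hb : 0 < exp l14 ^ 2 := by positivity
  rw [phiIK, ← hd, ← hm, div_mul_sqrt_mem_Ioo_iff two_pos hd₀,
    div_mul_sqrt_le_neg_one_iff two_pos hd₀, hn, hK, mul_pos_iff_of_pos_right hb,
    sub_pos (a := 2 ^ 2 * d), ← not_lt (b := m * _), ← not_lt (b := _ * exp l14 ^ 2), mul_pos_iff_of_pos_right hab,
    mul_pos_iff_of_pos_right hb, sub_pos (a := 2 ^ 2 * d), not_lt, not_lt]
  exact ⟨Iff.rfl, Iff.rfl⟩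

end Angles

/-- Lemma 3.9(4) for 2-2 type tetrahedra: for `l12 > 0`, `l ∉ ℒ` iff one of
`φ₁₂(l) ≤ −1`, `φ₁₃(l) ≤ −1`, `φ₁₄(l) ≤ −1` holds, and at most one of these three
conditions can hold; thus `ℛ ∖ ℒ = Ω₁₂⁻ ⊔ Ω₁₃⁻ ⊔ Ω₁₄⁻` is a disjoint union. -/
theorem complement_L_decomposition (l12 l13 l14 l23 l24 l34 : ℝ) (h : 0 < l12) :
    (¬ memL l12 l13 l14 l23 l24 l34 ↔
      (phi12 l12 l13 l14 l23 l24 l34 ≤ -1 ∨ phi13 l12 l13 l14 l23 l24 l34 ≤ -1 ∨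
        phi14 l12 l13 l14 l23 l24 l34 ≤ -1)) ∧
    ¬ (phi12 l12 l13 l14 l23 l24 l34 ≤ -1 ∧ phi13 l12 l13 l14 l23 l24 l34 ≤ -1) ∧
    ¬ (phi12 l12 l13 l14 l23 l24 l34 ≤ -1 ∧ phi14 l12 l13 l14 l23 l24 l34 ≤ -1) ∧
    ¬ (phi13 l12 l13 l14 l23 l24 l34 ≤ -1 ∧ phi14 l12 l13 l14 l23 l24 l34 ≤ -1) := by
  have hc : 1 < cosh l12 := one_lt_cosh.2 h.ne'
  have hc₀ : 0 < cosh l12 := cosh_pos _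
  have ha := exp_pos l13
  have hb := exp_pos l14
  have hp := exp_pos l23
  have hq := exp_pos l24
  have hz := exp_pos l34
  obtain ⟨mem12, le12⟩ := phi12_mem_Ioo_iff_and_le_neg_one_iff l12 l13 l14 l23 l24 l34 h
  obtain ⟨mem13, le13⟩ := phiIK_mem_Ioo_iff_and_le_neg_one_iff l12 l13 l14 l23 l24 l34
  obtain ⟨mem14, le14⟩ := phiIK_mem_Ioo_iff_and_le_neg_one_iff l12 l14 l13 l24 l23 l34
  have mem23 := (phiIK_mem_Ioo_iff_and_le_neg_one_iff l12 l23 l24 l13 l14 l34).1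
  have mem24 := (phiIK_mem_Ioo_iff_and_le_neg_one_iff l12 l24 l23 l14 l13 l34).1
  have K14 : lengthNegGramDet l12 l14 l13 l24 l23 l34 =
      lengthNegGramDet l12 l13 l14 l23 l24 l34 := negGramDet_swap_ideal ..
  have K23 : lengthNegGramDet l12 l23 l24 l13 l14 l34 =
      lengthNegGramDet l12 l13 l14 l23 l24 l34 := negGramDet_swap_hyperideal ..
  have K24 : lengthNegGramDet l12 l24 l23 l14 l13 l34 =
      lengthNegGramDet l12 l13 l14 l23 l24 l34 :=
    (negGramDet_swap_hyperideal ..).trans (negGramDet_swap_ideal ..)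
  rw [K14] at mem14 le14
  rw [K23] at mem23
  rw [K24] at mem24
  have not12_13 := not_gramCofactor12_nonpos_and_gramCofactorIK_nonpos (z := exp l34) hc ha hb hp hq
  have not12_14 := not_gramCofactor12_nonpos_and_gramCofactorIK_nonpos (z := exp l34) hc hb ha hq hp
  have not13_14 := not_gramCofactorIK_nonpos_and_nonpos hc₀ ha hb hp hq hz
  have swap12 : gramCofactor12 (cosh l12) (exp l14) (exp l13) (exp l24) (exp l23) (exp l34) =
      gramCofactor12 (cosh l12) (exp l13) (exp l14) (exp l23) (exp l24) (exp l34) := by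
    unfold gramCofactor12; ring
  rw [swap12] at not12_14
  have hex := exists_gramCofactor_nonpos (c := cosh l12) hc₀ ha hb hp hq hz
  change lengthNegGramDet l12 l13 l14 l23 l24 l34 ≤ 0 → _ at hex
  rw [memL, phi13, phi14, phi23, phi24, mem12, mem13, mem14, mem23, mem24,
    phi34_mem_Ioo_iff, le12, le13, le14]
  simp only [and_self, not_lt]
  refine ⟨⟨fun hK => ?_, ?_⟩, fun hle => not12_13 ⟨hle.1.1, hle.2.1⟩,
    fun hle => not12_14 ⟨hle.1.1, hle.2.1⟩, fun hle => not13_14 ⟨hle.1.1, hle.2.1⟩⟩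
  · exact (hex hK).imp (⟨·, hK⟩) (Or.imp (⟨·, hK⟩) (⟨·, hK⟩))
  · rintro (hle | hle | hle) <;> exact hle.2
end

section
/- (Lemma 3.2: φ12 agrees with the hyperbolic cosine law at the hyper-ideal vertex 1 of a 2-2 type tetrahedron.) Let l = (l12, l13, l14, l23, l24, l34) ∈ ℝ^6 with l12 > 0, and set A = (e^{l23} + e^{l13}·cosh l12)/(e^{l13}·sinh l12), B = (e^{l24} + e^{l14}·cosh l12)/(e^{l14}·sinh l12), C = 2·e^{l34−l13−l14} + 1 (these are cosh θ23¹, cosh θ24¹, cosh θ34¹, the hyperbolic cosines of the side lengths of the vertex triangle at v1). Then A > 1, B > 1, C > 1, and φ12(l) = (A·B − C) / (√(A² − 1)·√(B² − 1)). -/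
open Real

theorem one_lt_add_mul_cosh_div_mul_sinh {x a l : ℝ} (hx : 0 < x) (ha : 0 < a) (hl : 0 < l) :
    1 < (x + a * cosh l) / (a * sinh l) := by
  rw [one_lt_div (mul_pos ha (sinh_pos_iff.2 hl))]
  have := mul_lt_mul_of_pos_left (sinh_lt_cosh l) ha
  linarith

theorem sqrt_sq_add_mul_cosh_div_mul_sinh_sub_one {x a l : ℝ} (ha : 0 < a) (hl : 0 < l) :
    √(((x + a * cosh l) / (a * sinh l)) ^ 2 - 1) =
      √(x ^ 2 + 2 * (x * a) * cosh l + a ^ 2) / (a * sinh l) := by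
  have hs : 0 < a * sinh l := mul_pos ha (sinh_pos_iff.2 hl)
  rw [← sqrt_sq hs.le, ← sqrt_div' _ (sq_nonneg _), sqrt_sq hs.le, div_pow,
    div_sub_one (pow_ne_zero 2 hs.ne')]
  congr 2
  linear_combination a ^ 2 * cosh_sq l

/-- Lemma 3.2: for `l12 > 0`, `φ₁₂` agrees with the hyperbolic cosine law at the
hyper-ideal vertex `v₁` of a 2-2 type tetrahedron: with
`A = cosh θ²₃¹`, `B = cosh θ²₄¹`, `C = cosh θ³₄¹` as below, one has `A, B, C > 1` and
`φ₁₂(l) = (A·B − C)/(√(A²−1)·√(B²−1))`. -/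
theorem phi12_eq_cosine_law (l12 l13 l14 l23 l24 l34 : ℝ) (h : 0 < l12)
    (A B C : ℝ)
    (hA : A = (exp l23 + exp l13 * cosh l12) / (exp l13 * sinh l12))
    (hB : B = (exp l24 + exp l14 * cosh l12) / (exp l14 * sinh l12))
    (hC : C = 2 * exp (l34 - l13 - l14) + 1) :
    1 < A ∧ 1 < B ∧ 1 < C ∧
    phi12 l12 l13 l14 l23 l24 l34 =
      (A * B - C) / (Real.sqrt (A ^ 2 - 1) * Real.sqrt (B ^ 2 - 1)) := by
  have hs : 0 < sinh l12 := sinh_pos_iff.2 h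
  refine ⟨hA ▸ one_lt_add_mul_cosh_div_mul_sinh (exp_pos _) (exp_pos _) h,
    hB ▸ one_lt_add_mul_cosh_div_mul_sinh (exp_pos _) (exp_pos _) h,
    by rw [hC]; linarith [exp_pos (l34 - l13 - l14)], ?_⟩
  have hexp (u : ℝ) : exp (2 * u) = exp u ^ 2 := by rw [two_mul, exp_add, sq]
  have hP : 0 < exp l23 ^ 2 + 2 * (exp l23 * exp l13) * cosh l12 + exp l13 ^ 2 := by
    have := cosh_pos l12
    positivity
  have hQ : 0 < exp l24 ^ 2 + 2 * (exp l24 * exp l14) * cosh l12 + exp l14 ^ 2 := by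
    have := cosh_pos l12
    positivity
  have hQ' : exp l14 ^ 2 + 2 * (exp l24 * exp l14) * cosh l12 + exp l24 ^ 2 =
      exp l24 ^ 2 + 2 * (exp l24 * exp l14) * cosh l12 + exp l14 ^ 2 := by ring
  subst hA hB hC
  rw [sqrt_sq_add_mul_cosh_div_mul_sinh_sub_one (exp_pos _) h,
    sqrt_sq_add_mul_cosh_div_mul_sinh_sub_one (exp_pos _) h, phi12]
  simp only [hexp, exp_add, exp_sub]
  rw [hQ', sqrt_mul hP.le]
  have hP' := sqrt_pos.2 hP
  have hQ'' := sqrt_pos.2 hQ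
  set p := √(exp l23 ^ 2 + 2 * (exp l23 * exp l13) * cosh l12 + exp l13 ^ 2)
  set q := √(exp l24 ^ 2 + 2 * (exp l24 * exp l14) * cosh l12 + exp l14 ^ 2)
  field_simp
  linear_combination (exp l23 * exp l24 - exp l13 * exp l14) * cosh_sq l12
end

section
/- (Lemma 3.2: φ34 agrees with the Euclidean cosine law on the horosphere at the ideal vertex 3 of a 2-2 type tetrahedron.) For every l = (l12, l13, l14, l23, l24, l34) ∈ ℝ^6, set P = √((e^{l14} + e^{l34−l13})/e^{l13+l34}), Q = √((e^{l24} + e^{l34−l23})/e^{l23+l34}), and R² = 2·(cosh l12 + cosh(l13 − l23))/e^{l13+l23} (these are θ14³, θ24³ and (θ12³)², the Euclidean side lengths of the horospherical triangle at v3). Then φ34(l) = (P² + Q² − R²) / (2·P·Q). -/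
open Real

/-- Lemma 3.2: `φ₃₄` agrees with the Euclidean cosine law on the horosphere at the
ideal vertex `v₃` of a 2-2 type tetrahedron: with `P = θ₁₄³`, `Q = θ₂₄³` and
`R2 = (θ₁₂³)²` as below, one has `φ₃₄(l) = (P² + Q² − R²)/(2·P·Q)`. -/
theorem phi34_eq_euclidean_cosine_law (l12 l13 l14 l23 l24 l34 : ℝ)
    (P Q R2 : ℝ)
    (hP : P = Real.sqrt ((exp l14 + exp (l34 - l13)) / exp (l13 + l34)))
    (hQ : Q = Real.sqrt ((exp l24 + exp (l34 - l23)) / exp (l23 + l34)))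
    (hR : R2 = 2 * (cosh l12 + cosh (l13 - l23)) / exp (l13 + l23)) :
    phi34 l12 l13 l14 l23 l24 l34 = (P ^ 2 + Q ^ 2 - R2) / (2 * P * Q) := by
  have ha := exp_pos l13
  have hb := exp_pos l14
  have hc := exp_pos l23
  have hd := exp_pos l24
  have hf := exp_pos l34
  have hP_sq : P ^ 2 = (exp l14 + exp (l34 - l13)) / exp (l13 + l34) := by
    rw [hP, sq_sqrt (by positivity)]
  have hQ_sq : Q ^ 2 = (exp l24 + exp (l34 - l23)) / exp (l23 + l34) := by
    rw [hQ, sq_sqrt (by positivity)]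
  have h_sqrt : Real.sqrt ((exp (l24 + l23) + exp l34) * (exp (l14 + l13) + exp l34)) =
      exp l13 * exp l23 * exp l34 * (P * Q) := by
    have hP_nonneg : 0 ≤ P := hP ▸ sqrt_nonneg _
    have hQ_nonneg : 0 ≤ Q := hQ ▸ sqrt_nonneg _
    rw [sqrt_eq_iff_eq_sq (by positivity) (by positivity), mul_pow, mul_pow P, hP_sq, hQ_sq]
    simp only [exp_add, exp_sub]
    field_simp
  have h_num : exp (l24 + l13) + exp (l14 + l23) - 2 * exp l34 * cosh l12 =
      exp l13 * exp l23 * exp l34 * (P ^ 2 + Q ^ 2 - R2) := by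
    rw [hP_sq, hQ_sq, hR, cosh_eq (l13 - l23), neg_sub]
    simp only [exp_add, exp_sub]
    field_simp
    ring
  rw [phi34, h_sqrt, h_num, mul_left_comm 2, ← mul_assoc 2 P Q,
    mul_div_mul_left _ _ (by positivity)]
end

section
/- (Theorem 6.6(1), abstract form: a bounded negative gradient flow trajectory forces the existence of a critical point.) Let n ≥ 1, let H : ℝ^n → ℝ be continuously differentiable with gradient ∇H, and let x : [0, ∞) → ℝ^n be differentiable with x'(t) = −∇H(x(t)) for all t ≥ 0. If there is a constant C with ‖x(t)‖ ≤ C for all t ≥ 0, then there exists z ∈ ℝ^n with ∇H(z) = 0. (Contrapositive, as stated in the paper: if ∇H has no zeros, then the solution leaves every bounded set along some sequence of times t_n → ∞.) -/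
/-- Theorem 6.6(1) (abstract form): if a global-in-time trajectory of the negative
gradient flow `x' = −∇H(x)` of a `C¹` function `H` stays in a bounded set, then `∇H`
has a zero.  (Contrapositive, as in the paper: if there is no critical point, the
solution leaves every bounded set along some sequence of times `tₙ → ∞`.) -/
theorem bounded_gradient_flow_trajectory_gives_critical_point (n : ℕ) (hn : 1 ≤ n)
    (H : EuclideanSpace ℝ (Fin n) → ℝ) (hH : ContDiff ℝ 1 H)
    (x : ℝ → EuclideanSpace ℝ (Fin n))
    (hode : ∀ t : ℝ, 0 ≤ t → HasDerivAt x (-gradient H (x t)) t)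
    (C : ℝ) (hbound : ∀ t : ℝ, 0 ≤ t → ‖x t‖ ≤ C) :
    ∃ z : EuclideanSpace ℝ (Fin n), gradient H z = 0 := by
  by_contra! hne
  have hgc : Continuous (gradient H) :=
    (InnerProductSpace.toDual ℝ (EuclideanSpace ℝ (Fin n))).symm.continuous.comp
      (hH.continuous_fderiv one_ne_zero)
  have hmem : ∀ t : ℝ, 0 ≤ t → x t ∈ Metric.closedBall (0 : EuclideanSpace ℝ (Fin n)) C :=
    fun t ht => mem_closedBall_zero_iff.2 (hbound t ht)
  have hK := isCompact_closedBall (0 : EuclideanSpace ℝ (Fin n)) C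
  obtain ⟨z, -, hz⟩ := hK.exists_isMinOn ⟨_, hmem 0 le_rfl⟩
    (hgc.norm.pow 2).continuousOn
  obtain ⟨w, -, hw⟩ := hK.exists_isMinOn ⟨_, hmem 0 le_rfl⟩ hH.continuous.continuousOn
  set m := ‖gradient H z‖ ^ 2 with hm
  have hmpos : 0 < m := by
    have := norm_pos_iff.2 (hne z)
    positivity
  have hderiv : ∀ t : ℝ, 0 ≤ t →
      HasDerivAt (fun s => H (x s)) (-‖gradient H (x t)‖ ^ 2) t := by
    intro t ht
    have hd := ((hH.differentiable one_ne_zero) (x t)).hasGradientAt.hasFDerivAt.comp_hasDerivAt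
      t (hode t ht)
    rwa [InnerProductSpace.toDual_apply_apply, inner_neg_right, real_inner_self_eq_norm_sq] at hd
  have hdecay : AntitoneOn (fun t => H (x t) + m * t) (Set.Ici 0) := by
    have hd : ∀ t : ℝ, 0 ≤ t → HasDerivAt (fun s => H (x s) + m * s)
        (-‖gradient H (x t)‖ ^ 2 + m) t := fun t ht => by
      simpa using (hderiv t ht).fun_add ((hasDerivAt_id t).const_mul m)
    refine antitoneOn_of_hasDerivWithinAt_nonpos (convex_Ici 0)
      (fun t ht => (hd t ht).continuousAt.continuousWithinAt)
      (fun t ht => (hd t (interior_subset ht)).hasDerivWithinAt) fun t ht => ?_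
    have : m ≤ ‖gradient H (x t)‖ ^ 2 := hz (hmem t (interior_subset ht))
    linarith
  have hw0 : H w ≤ H (x 0) := hw (hmem 0 le_rfl)
  have hT : 0 ≤ (H (x 0) - H w + 1) / m := div_nonneg (by linarith) hmpos.le
  have hle := hdecay Set.self_mem_Ici hT hT
  have hwT : H w ≤ H (x ((H (x 0) - H w + 1) / m)) := hw (hmem _ hT)
  simp only [mul_div_cancel₀ _ hmpos.ne', mul_zero] at hle
  linarith [mul_div_cancel₀ (H (x 0) - H w + 1) hmpos.ne']
end

section
/- (Analytic core of the proof of Theorem 1.2 / Theorem 5.1: local strict convexity makes the gradient injective.) Let E be a finite-dimensional real inner product space and let f : E → ℝ be differentiable and convex on all of E. Suppose there exist ε₁ > 0 and ε₂ > 0 such that f is strictly convex on the open ball B(x, ε₁) and strictly convex on the open ball B(y, ε₂). If ∇f(x) = ∇f(y), then x = y. (In the paper, f is the total co-volume function cov on the metric space modulo decorations, whose gradient is (2π,…,2π) − K; this yields that the curvature map determines the decorated hyperbolic polyhedral metric.) -/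
/-- The first-order characterization of convexity: a convex function lies above its tangent
hyperplane at any point of differentiability. -/
theorem ConvexOn.add_inner_gradient_le
    {E : Type*} [NormedAddCommGroup E] [InnerProductSpace ℝ E] [CompleteSpace E]
    {f : E → ℝ} {s : Set E} {x z : E} (hf : ConvexOn ℝ s f) (hx : x ∈ s) (hz : z ∈ s)
    (hd : DifferentiableAt ℝ f x) :
    f x + inner ℝ (gradient f x) (z - x) ≤ f z := by
  let g : ℝ →ᵃ[ℝ] E := AffineMap.lineMap x z
  have hg0 : g 0 = x := AffineMap.lineMap_apply_zero x z
  have hg1 : g 1 = z := AffineMap.lineMap_apply_one x z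
  have hderiv : HasDerivAt (f ∘ g) (inner ℝ (gradient f x) (z - x)) 0 := by
    have hfx : HasFDerivAt f (InnerProductSpace.toDual ℝ E (gradient f x)) (g 0) :=
      hg0.symm ▸ hd.hasGradientAt.hasFDerivAt
    simpa using hfx.comp_hasDerivAt (0 : ℝ) AffineMap.hasDerivAt_lineMap
  have hslope := (hf.comp_affineMap g).le_slope_of_hasDerivAt (x := 0) (y := 1)
    (by simpa [hg0] using hx) (by simpa [hg1] using hz) one_pos hderiv
  simp only [slope_def_field, Function.comp_apply, hg0, hg1, sub_zero, div_one] at hslope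
  linarith

/-- Analytic core of the proof of Theorem 1.2 / Theorem 5.1: if a differentiable convex
function `f` on a finite-dimensional real inner product space is strictly convex on a
ball around `x` and on a ball around `y`, and `∇f(x) = ∇f(y)`, then `x = y`.
(In the paper, `f` is the total co-volume function; this yields that the curvature map
determines the decorated hyperbolic polyhedral metric.) -/
theorem gradient_injective_of_local_strict_convexity
    {E : Type*} [NormedAddCommGroup E] [InnerProductSpace ℝ E] [FiniteDimensional ℝ E]
    (f : E → ℝ) (hdiff : Differentiable ℝ f)
    (hconv : ConvexOn ℝ Set.univ f)
    (x y : E) (ε₁ ε₂ : ℝ) (hε₁ : 0 < ε₁) (hε₂ : 0 < ε₂)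
    (hx : StrictConvexOn ℝ (Metric.ball x ε₁) f)
    (hy : StrictConvexOn ℝ (Metric.ball y ε₂) f)
    (hgrad : gradient f x = gradient f y) :
    x = y := by
  by_contra hne
  obtain ⟨s, hs0, hs1, hsball⟩ :
      ∃ s : ℝ, 0 < s ∧ s < 1 ∧ AffineMap.lineMap x y s ∈ Metric.ball x ε₁ := by
    have hcont : Filter.Tendsto (fun s : ℝ => AffineMap.lineMap x y s)
        (nhdsWithin 0 (Set.Ioi 0)) (nhds x) := by
      have h : Continuous (fun s : ℝ => AffineMap.lineMap x y s) := AffineMap.lineMap_continuous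
      simpa using (h.tendsto 0).mono_left nhdsWithin_le_nhds
    obtain ⟨s, hsball, hs⟩ := ((hcont.eventually (Metric.ball_mem_nhds x hε₁)).and
      (Ioo_mem_nhdsGT (zero_lt_one' ℝ))).exists
    exact ⟨s, hs.1, hs.2, hsball⟩
  set w : E := AffineMap.lineMap x y s with hw
  have hw_eq : w = (1 - s) • x + s • y := AffineMap.lineMap_apply_module x y s
  have hw_sub : w - x = s • (y - x) := by rw [hw_eq]; module
  have hxw : x ≠ w := by
    intro h
    have h0 : s • (y - x) = 0 := by rw [← hw_sub, ← h, sub_self]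
    rcases smul_eq_zero.1 h0 with h1 | h1
    · exact hs0.ne' h1
    · exact hne (sub_eq_zero.1 h1).symm
  have hstrict := hx.2 (Metric.mem_ball_self hε₁) hsball hxw
    one_half_pos one_half_pos (add_halves (1 : ℝ))
  have hchord := hconv.2 (Set.mem_univ x) (Set.mem_univ y)
    (sub_nonneg.2 hs1.le) hs0.le (sub_add_cancel 1 s)
  rw [← hw_eq] at hchord
  have hmid := hconv.add_inner_gradient_le (Set.mem_univ x)
    (Set.mem_univ ((1 / 2 : ℝ) • x + (1 / 2 : ℝ) • w)) (hdiff x)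
  have hmid_sub : (1 / 2 : ℝ) • x + (1 / 2 : ℝ) • w - x = (s / 2) • (y - x) := by
    rw [hw_eq]; module
  rw [hmid_sub, inner_smul_right] at hmid
  have hyx := hconv.add_inner_gradient_le (Set.mem_univ y) (Set.mem_univ x) (hdiff y)
  rw [← hgrad, ← neg_sub y x, inner_neg_right] at hyx
  simp only [smul_eq_mul] at hstrict hchord
  nlinarith [mul_le_mul_of_nonneg_left hyx hs0.le]
end

section
/- (Analytic core of the proof of Theorem 6.5 (properness of the H-functional): a convex function with a strict local minimum is coercive.) Let E be a finite-dimensional real normed space and let f : E → ℝ be convex on all of E. Suppose x₀ ∈ E is a strict local minimum of f, i.e. there is r > 0 such that f(x) > f(x₀) for all x with 0 < ‖x − x₀‖ ≤ r. Then f is proper (coercive): f(x) → +∞ as ‖x‖ → ∞; equivalently, for every M ∈ ℝ there is R > 0 such that f(x) > M whenever ‖x‖ > R. (In the paper, f is the functional H(l) = cov(l) − 2π·Σ_i l_i on the space of generalized decorated metrics modulo change of decorations, x₀ is the unique zero-curvature decorated metric, and the conclusion is that H is proper on ℝ^E/∼.) -/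
/-- A convex function exceeding `f x₀` by at least `m` on the sphere of radius `r` around `x₀`
grows at least linearly, with slope `m / r`, outside that sphere. -/
theorem ConvexOn.add_div_mul_norm_sub_le_of_le_on_sphere
    {E : Type*} [NormedAddCommGroup E] [NormedSpace ℝ E] {f : E → ℝ}
    (hf : ConvexOn ℝ Set.univ f) {x₀ : E} {r m : ℝ} (hr : 0 < r)
    (hm : ∀ y ∈ Metric.sphere x₀ r, f x₀ + m ≤ f y) {x : E} (hx : r ≤ ‖x - x₀‖) :
    f x₀ + m / r * ‖x - x₀‖ ≤ f x := by
  have hd : 0 < ‖x - x₀‖ := hr.trans_le hx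
  set t := r / ‖x - x₀‖ with ht
  have ht0 : 0 < t := div_pos hr hd
  have ht1 : t ≤ 1 := (div_le_one hd).2 hx
  have hy : t • x + (1 - t) • x₀ ∈ Metric.sphere x₀ r := by
    have h : t • x + (1 - t) • x₀ - x₀ = t • (x - x₀) := by module
    rw [mem_sphere_iff_norm, h, norm_smul, Real.norm_of_nonneg ht0.le, ht,
      div_mul_cancel₀ _ hd.ne']
  have hc := hf.2 (Set.mem_univ x) (Set.mem_univ x₀) ht0.le (sub_nonneg.2 ht1) (by ring)
  simp only [smul_eq_mul] at hc
  have hmt : m ≤ (f x - f x₀) * t := by linarith [hm _ hy]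
  have hslope : m / r * ‖x - x₀‖ = m / t := by
    rw [ht]
    field_simp
  linarith [(div_le_iff₀ ht0).2 hmt]

/-- A convex function on a finite-dimensional space that exceeds `f x₀` on a sphere around `x₀`
does so by a uniform positive amount. -/
theorem ConvexOn.exists_pos_add_le_on_sphere
    {E : Type*} [NormedAddCommGroup E] [NormedSpace ℝ E] [FiniteDimensional ℝ E] {f : E → ℝ}
    (hf : ConvexOn ℝ Set.univ f) {x₀ : E} {r : ℝ}
    (hmin : ∀ y ∈ Metric.sphere x₀ r, f x₀ < f y) :
    ∃ m > 0, ∀ y ∈ Metric.sphere x₀ r, f x₀ + m ≤ f y := by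
  have : ProperSpace E := FiniteDimensional.proper ℝ E
  rcases (Metric.sphere x₀ r).eq_empty_or_nonempty with he | hne
  · exact ⟨1, one_pos, by simp [he]⟩
  · have hcont : ContinuousOn f (Metric.sphere x₀ r) :=
      (hf.continuousOn isOpen_univ).mono (Set.subset_univ _)
    obtain ⟨z, hz, hzmin⟩ := (isCompact_sphere x₀ r).exists_isMinOn hne hcont
    refine ⟨f z - f x₀, sub_pos.2 (hmin z hz), fun y hy => ?_⟩
    rw [add_sub_cancel]
    exact hzmin hy


/-- Analytic core of the proof of Theorem 6.5 (properness of the `H`-functional): a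
convex function on a finite-dimensional real normed space with a strict local minimum
is proper (coercive): `f(x) → +∞` as `‖x‖ → ∞`, i.e. for every `M` there is `R > 0`
such that `f(x) > M` whenever `‖x‖ > R`. -/
theorem convex_with_strict_local_min_is_proper
    {E : Type*} [NormedAddCommGroup E] [NormedSpace ℝ E] [FiniteDimensional ℝ E]
    (f : E → ℝ) (hconv : ConvexOn ℝ Set.univ f)
    (x₀ : E) (r : ℝ) (hr : 0 < r)
    (hmin : ∀ x : E, 0 < ‖x - x₀‖ → ‖x - x₀‖ ≤ r → f x₀ < f x) :
    ∀ M : ℝ, ∃ R > 0, ∀ x : E, R < ‖x‖ → M < f x := by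
  intro M
  obtain ⟨m, hm, hsphere⟩ := hconv.exists_pos_add_le_on_sphere (x₀ := x₀) (r := r) fun y hy => by
    rw [mem_sphere_iff_norm] at hy
    exact hmin y (hy ▸ hr) hy.le
  refine ⟨‖x₀‖ + r + |M - f x₀| / (m / r), by positivity, fun x hx => ?_⟩
  have hnorm : ‖x‖ - ‖x₀‖ ≤ ‖x - x₀‖ := norm_sub_norm_le x x₀
  have habs : 0 ≤ |M - f x₀| / (m / r) := by positivity
  have hgrowth := hconv.add_div_mul_norm_sub_le_of_le_on_sphere hr hsphere
    (x := x) (by linarith)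
  have hlarge : |M - f x₀| / (m / r) < ‖x - x₀‖ := by linarith
  rw [div_lt_iff₀' (div_pos hm hr)] at hlarge
  linarith [le_abs_self (M - f x₀)]
end
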